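/- Let B be a Noetherian commutative ring and t ∈ B a non-zerodivisor. Let P = B[z_1,…,z_n] be the polynomial ring, f_1,…,f_m ∈ P, and A = P/(f_1,…,f_m); assume A is flat as a B-module. Let A' be a commutative finite-type B-algebra that is flat as a B-module, let k ≥ 1, and let φ : A/t^kA → A'/t^kA' be an isomorphism of B-algebras. Choose elements ẑ_1,…,ẑ_n ∈ A' lifting the images φ(z̄_1),…,φ(z̄_n), and regard A' as a P-module via the B-algebra map P → A' sending z_i ↦ ẑ_i. Let I be the ideal of P generated by t, and let π̂ : AdicCompletion I P → AdicCompletion I A' be the induced map of I-adic completions. Then there exist elements g_1,…,g_m of AdicCompletion I P such that the kernel of π̂ equals the ideal of the ring AdicCompletion I P generated by the m elements ι(f_i) + ι(t)^k·g_i (i = 1,…,m), where ι : P → AdicCompletion I P is the canonical map. -/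

import Mathlib

theorem Submodule.mem_span_singleton_pow_smul_top {R M : Type*} [CommRing R] [AddCommGroup M]
    [Module R M] {t : R} {n : ℕ} {x : M} :
    x ∈ (Ideal.span {t} ^ n • ⊤ : Submodule R M) ↔ ∃ y : M, x = t ^ n • y := by
  rw [Ideal.span_singleton_pow, Submodule.ideal_span_singleton_smul,
    Submodule.mem_smul_pointwise_iff_exists]
  simp [eq_comm]

namespace AdicCompletion

open Submodule

variable {R M : Type*} [CommRing R] [AddCommGroup M] [Module R M] {t : R}

theorem isSMulRegular_span_singleton (ht : IsSMulRegular M t) :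
    IsSMulRegular (AdicCompletion (Ideal.span {t}) M) t := by
  refine isSMulRegular_iff_right_eq_zero_of_smul.2 fun x hx ↦ ?_
  induction x using AdicCompletion.induction_on with
  | _ a =>
  refine mk_zero_of _ _ _ ⟨0, fun n _ ↦ ⟨n + 1, n.le_succ, n, le_rfl, ?_⟩⟩
  have h : (t • AdicCompletion.mk (Ideal.span {t}) M a).val (n + 1) = 0 := by rw [hx]; rfl
  rw [← map_smul] at h
  have h' : t • a (n + 1) ∈ (Ideal.span {t} ^ (n + 1) • ⊤ : Submodule R M) :=
    (Submodule.Quotient.mk_eq_zero _).1 h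
  obtain ⟨y, hy⟩ := mem_span_singleton_pow_smul_top.1 h'
  rw [pow_succ', mul_smul] at hy
  exact mem_span_singleton_pow_smul_top.2 ⟨y, ht hy⟩

theorem exists_eq_of_add_pow_smul (n : ℕ) (x : AdicCompletion (Ideal.span {t}) M) :
    ∃ (p : M) (y : AdicCompletion (Ideal.span {t}) M), x = of _ M p + t ^ n • y := by
  obtain ⟨p, hp⟩ := Submodule.Quotient.mk_surjective _ (x.val n)
  have h : x - of _ M p ∈ (eval (Ideal.span {t}) M n).ker := by
    rw [LinearMap.mem_ker, map_sub, eval_apply, eval_of, mkQ_apply, hp, sub_self]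
  rw [← pow_smul_top_eq_ker_eval ⟨{t}, by simp⟩] at h
  obtain ⟨y, hy⟩ := mem_span_singleton_pow_smul_top.1 h
  exact ⟨p, y, by rw [← hy]; abel⟩

/-- If `q : R → M` is surjective modulo `t`, `t` is regular on `M`, and `f` generates the kernel of
`R → M / t ^ k M` modulo `t ^ k`, then `f` can be corrected by multiples of `t ^ k` to a generating
family of the kernel of the map induced by `q` on `t`-adic completions. -/
theorem exists_ker_map_eq_span {ι : Type*} [Finite ι] (ht : IsSMulRegular M t) (q : R →ₗ[R] M)
    (hq : ∀ y, ∃ p a, y = q p + t • a) {k : ℕ} (hk : k ≠ 0) (f : ι → R)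
    (hf : ∀ i, ∃ a, q (f i) = t ^ k • a)
    (hker : ∀ p a, q p = t ^ k • a → p ∈ Ideal.span (Set.range f) ⊔ Ideal.span {t ^ k}) :
    ∃ g : ι → AdicCompletion (Ideal.span {t}) R, ∀ x : AdicCompletion (Ideal.span {t}) R,
      map (Ideal.span {t}) q x = 0 ↔ x ∈ Ideal.span (Set.range fun i ↦
        algebraMap R (AdicCompletion (Ideal.span {t}) R) (f i) +
          algebraMap R (AdicCompletion (Ideal.span {t}) R) t ^ k * g i) := by
  classical
  have := Fintype.ofFinite ι
  set I := Ideal.span {t} with hI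
  have hIfg : I.FG := ⟨{t}, by simp [hI]⟩
  have hsurj : Function.Surjective (map I q) := by
    refine map_surjective_of_mkQ_comp_surjective fun y ↦ ?_
    obtain ⟨y, rfl⟩ := Submodule.Quotient.mk_surjective _ y
    obtain ⟨p, a, rfl⟩ := hq y
    refine ⟨p, ((Submodule.Quotient.eq _).2 ?_)⟩
    rw [sub_add_cancel_left, neg_mem_iff]
    exact smul_mem_smul (Ideal.mem_span_singleton_self t) mem_top
  have hreg : IsSMulRegular (AdicCompletion I M) (t ^ k) :=
    (isSMulRegular_span_singleton ht).pow k
  have hof (r : R) : algebraMap R (AdicCompletion I R) r = of I R r := rfl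
  choose a ha using hf
  choose g hg using fun i ↦ hsurj (-of I M (a i))
  refine ⟨g, ?_⟩
  set F : ι → AdicCompletion I R := fun i ↦ algebraMap R (AdicCompletion I R) (f i) +
    algebraMap R (AdicCompletion I R) t ^ k * g i with hF
  have hFker (i : ι) : map I q (F i) = 0 := by
    rw [hF]
    dsimp only
    rw [← map_pow, ← Algebra.smul_def, map_add, LinearMap.map_smul_of_tower, hg, hof, map_of, ha,
      map_smul, smul_neg, add_neg_cancel]
  have hmulF (r : AdicCompletion I R) (i : ι) : map I q (r * F i) = 0 :=
    ((map I q).map_smul r (F i)).trans (by rw [hFker, smul_zero])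
  let N : Submodule R (AdicCompletion I R) := (map I q).ker.restrictScalars R
  let Φ : (ι → AdicCompletion I R) →ₗ[R] N :=
    ((Fintype.linearCombination (AdicCompletion I R) F).restrictScalars R).codRestrict N
      fun c ↦ by
        change map I q (∑ i, c i * F i) = 0
        simp only [map_sum, hmulF, Finset.sum_const_zero]
  have hΦ (c) : (Φ c : AdicCompletion I R) = ∑ i, c i * F i := rfl
  have : IsAdicComplete I (AdicCompletion I (ι → R)) := isAdicComplete hIfg
  have : IsHausdorff I N := by
    refine ⟨fun x hx ↦ Subtype.ext (IsHausdorff.haus (I := I) inferInstance _ fun n ↦ ?_)⟩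
    have h := hx n
    rw [SModEq.zero, mem_span_singleton_pow_smul_top] at h ⊢
    obtain ⟨y, rfl⟩ := h
    exact ⟨y, rfl⟩
  let e := (piEquivOfFintype I (fun _ : ι ↦ R)).restrictScalars R
  have hΦsurj : Function.Surjective (Φ ∘ₗ e.toLinearMap) := by
    refine surjective_of_mkQ_comp_surjective (I := I) fun x ↦ ?_
    obtain ⟨⟨x, hx⟩, rfl⟩ := Submodule.Quotient.mk_surjective _ x
    obtain ⟨p, y, rfl⟩ := exists_eq_of_add_pow_smul k x
    replace hx : map I q (of I R p + t ^ k • y) = 0 := hx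
    have hp : q p ∈ (I ^ k • ⊤ : Submodule R M) := by
      rw [map_add, LinearMap.map_smul_of_tower, map_of, add_eq_zero_iff_eq_neg, ← smul_neg] at hx
      have h : of I M (q p) ∈ (eval I M k).ker :=
        pow_smul_top_le_ker_eval I k (mem_span_singleton_pow_smul_top.2 ⟨_, hx⟩)
      rwa [LinearMap.mem_ker, eval_of, mkQ_apply, Submodule.Quotient.mk_eq_zero] at h
    obtain ⟨b, hb⟩ := mem_span_singleton_pow_smul_top.1 hp
    obtain ⟨u, hu, v, hv, rfl⟩ := mem_sup.1 (hker p b hb)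
    obtain ⟨c, rfl⟩ := (Ideal.mem_span_range_iff_exists_fun).1 hu
    obtain ⟨s, rfl⟩ := Ideal.mem_span_singleton'.1 hv
    set w : AdicCompletion I R := of I R s + y - ∑ i, of I R (c i) * g i with hw
    have hxw : of I R (∑ i, c i * f i + s * t ^ k) + t ^ k • y =
        ∑ i, of I R (c i) * F i + t ^ k • w := by
      simp only [hw, hF, ← hof, map_add, map_sum, map_mul, map_pow, Algebra.smul_def, mul_add,
        Finset.sum_add_distrib, mul_left_comm _ (algebraMap R (AdicCompletion I R) t ^ k),
        ← Finset.mul_sum]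
      ring
    have hwN : w ∈ N := by
      rw [hxw, map_add, map_sum, LinearMap.map_smul_of_tower] at hx
      simp only [hmulF, Finset.sum_const_zero, zero_add] at hx
      exact hreg.right_eq_zero_of_smul hx
    refine ⟨e.symm fun i ↦ of I R (c i), (Submodule.Quotient.eq _).2 ?_⟩
    obtain ⟨j, rfl⟩ := Nat.exists_eq_succ_of_ne_zero hk
    have : (Φ ∘ₗ e.toLinearMap) (e.symm fun i ↦ of I R (c i)) - ⟨_, hx⟩ =
        t • (-(t ^ j • (⟨w, hwN⟩ : N))) := by
      refine Subtype.ext ?_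
      rw [LinearMap.comp_apply, LinearEquiv.coe_coe, e.apply_symm_apply]
      change (Φ _ : AdicCompletion I R) - (of I R _ + _) = t • (-(t ^ j • w))
      rw [hΦ, hxw, smul_neg, smul_smul, ← pow_succ']
      abel
    rw [this]
    exact smul_mem_smul (Ideal.mem_span_singleton_self t) mem_top
  intro x
  refine ⟨fun hx ↦ ?_, fun hx ↦ ?_⟩
  · obtain ⟨c, hc⟩ := hΦsurj ⟨x, hx⟩
    have : x = ∑ i, e c i * F i := by
      rw [← hΦ]; exact congrArg Subtype.val hc.symm
    rw [this]
    exact sum_mem fun i _ ↦ Ideal.mul_mem_left _ _ (Ideal.subset_span ⟨i, rfl⟩)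
  · have : Ideal.span (Set.range F) ≤ (map I q).ker :=
      Ideal.span_le.2 (Set.range_subset_iff.2 hFker)
    exact this hx

end AdicCompletion

/-- Proposition 'Lifting equations': Let `B` be Noetherian, `t ∈ B` a
non-zerodivisor, `P = B[z_1,…,z_n]`, `A = P/(f_1,…,f_m)` flat over `B`, `A'` a flat
finite-type `B`-algebra, `φ : A/t^kA ≅ A'/t^kA'` a `B`-algebra isomorphism (`k ≥ 1`),
and `ẑ_i ∈ A'` lifts of `φ(z̄_i)`.  Regard `A'` as a `P`-module via `z_i ↦ ẑ_i` and let
`I = (t) ⊆ P`.  Then there are `g_1,…,g_m` in the `I`-adic completion of `P` such that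
the kernel of the induced map `π̂ : AdicCompletion I P → AdicCompletion I A'` is the
ideal generated by the elements `ι(f_i) + ι(t)^k·g_i`. -/
theorem lifting_equations
    {B : Type*} [CommRing B] [IsNoetherianRing B] (t : B) (ht : t ∈ nonZeroDivisors B)
    (n m : ℕ) (f : Fin m → MvPolynomial (Fin n) B)
    (hA : Module.Flat B (MvPolynomial (Fin n) B ⧸ Ideal.span (Set.range f)))
    {A' : Type*} [CommRing A'] [Algebra B A'] [Algebra.FiniteType B A'] [Module.Flat B A']
    (k : ℕ) (hk : 1 ≤ k)
    (φ : ((MvPolynomial (Fin n) B ⧸ Ideal.span (Set.range f)) ⧸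
        Ideal.span {algebraMap B (MvPolynomial (Fin n) B ⧸ Ideal.span (Set.range f)) t ^ k})
        ≃ₐ[B] (A' ⧸ Ideal.span {algebraMap B A' t ^ k}))
    (zhat : Fin n → A')
    (hzhat : ∀ i : Fin n,
      Ideal.Quotient.mk (Ideal.span {algebraMap B A' t ^ k}) (zhat i) =
      φ (Ideal.Quotient.mk _
        (Ideal.Quotient.mk (Ideal.span (Set.range f)) (MvPolynomial.X i)))) :
    letI : Algebra (MvPolynomial (Fin n) B) A' :=
      (MvPolynomial.aeval zhat : MvPolynomial (Fin n) B →ₐ[B] A').toRingHom.toAlgebra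
    ∃ g : Fin m → AdicCompletion
        (Ideal.span {(MvPolynomial.C t : MvPolynomial (Fin n) B)}) (MvPolynomial (Fin n) B),
      ∀ x : AdicCompletion
          (Ideal.span {(MvPolynomial.C t : MvPolynomial (Fin n) B)}) (MvPolynomial (Fin n) B),
        AdicCompletion.map (Ideal.span {(MvPolynomial.C t : MvPolynomial (Fin n) B)})
            (Algebra.linearMap (MvPolynomial (Fin n) B) A') x = 0 ↔
        x ∈ Ideal.span (Set.range fun i : Fin m =>
          algebraMap (MvPolynomial (Fin n) B)
            (AdicCompletion (Ideal.span {(MvPolynomial.C t : MvPolynomial (Fin n) B)})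
              (MvPolynomial (Fin n) B)) (f i) +
          algebraMap (MvPolynomial (Fin n) B)
            (AdicCompletion (Ideal.span {(MvPolynomial.C t : MvPolynomial (Fin n) B)})
              (MvPolynomial (Fin n) B)) (MvPolynomial.C t) ^ k * g i) := by
  let : Algebra (MvPolynomial (Fin n) B) A' :=
    (MvPolynomial.aeval zhat : MvPolynomial (Fin n) B →ₐ[B] A').toRingHom.toAlgebra
  have hsmul (p : MvPolynomial (Fin n) B) (a : A') : p • a = MvPolynomial.aeval zhat p * a := rfl
  have htsmul (l : ℕ) (a : A') : (MvPolynomial.C t : MvPolynomial (Fin n) B) ^ l • a =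
      algebraMap B A' t ^ l * a := by
    rw [hsmul, map_pow, MvPolynomial.aeval_C]
  have hcomp (p : MvPolynomial (Fin n) B) :
      Ideal.Quotient.mk (Ideal.span {algebraMap B A' t ^ k}) (MvPolynomial.aeval zhat p) =
        φ (Ideal.Quotient.mk _ (Ideal.Quotient.mk (Ideal.span (Set.range f)) p)) := by
    have : (Ideal.Quotient.mkₐ B (Ideal.span {algebraMap B A' t ^ k})).comp
        (MvPolynomial.aeval zhat) = φ.toAlgHom.comp ((Ideal.Quotient.mkₐ B _).comp
          (Ideal.Quotient.mkₐ B (Ideal.span (Set.range f)))) :=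
      MvPolynomial.algHom_ext fun i ↦ by simpa using hzhat i
    exact DFunLike.congr_fun this p
  have hdvd (p : MvPolynomial (Fin n) B) : (∃ a : A', MvPolynomial.aeval zhat p =
      (MvPolynomial.C t : MvPolynomial (Fin n) B) ^ k • a) ↔
        p ∈ Ideal.span (Set.range f) ⊔ Ideal.span {MvPolynomial.C t ^ k} := by
    have h₁ : (∃ a : A', MvPolynomial.aeval zhat p =
        (MvPolynomial.C t : MvPolynomial (Fin n) B) ^ k • a) ↔
          Ideal.Quotient.mk (Ideal.span (Set.range f)) p ∈ Ideal.span {algebraMap B _ t ^ k} := by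
      simp only [htsmul]
      rw [← Ideal.Quotient.eq_zero_iff_mem, ← map_eq_zero_iff φ φ.injective, ← hcomp,
        Ideal.Quotient.eq_zero_iff_mem, Ideal.mem_span_singleton]
      rfl
    have h₂ : Ideal.span {algebraMap B (MvPolynomial (Fin n) B ⧸ Ideal.span (Set.range f)) t ^ k} =
        (Ideal.span {MvPolynomial.C t ^ k}).map (Ideal.Quotient.mk (Ideal.span (Set.range f))) := by
      rw [Ideal.map_span, Set.image_singleton, map_pow]
      rfl
    rw [h₁, h₂, ← Ideal.mem_comap, Ideal.comap_map_of_surjective _ Ideal.Quotient.mk_surjective,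
      ← RingHom.ker_eq_comap_bot, Ideal.mk_ker, sup_comm]
  refine AdicCompletion.exists_ker_map_eq_span ?_
    (Algebra.linearMap (MvPolynomial (Fin n) B) A') (fun y ↦ ?_) (Nat.one_le_iff_ne_zero.1 hk) f
    (fun i ↦ (hdvd _).2 (Ideal.mem_sup_left (Ideal.subset_span ⟨i, rfl⟩)))
    (fun p a h ↦ (hdvd p).1 ⟨a, h⟩)
  · intro a b hab
    have hreg : IsSMulRegular A' t := Module.Flat.isSMulRegular_of_nonZeroDivisors ht
    refine hreg ?_
    simpa [hsmul, Algebra.smul_def] using hab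
  · obtain ⟨x, hx⟩ := φ.surjective (Ideal.Quotient.mk _ y)
    obtain ⟨x, rfl⟩ := Ideal.Quotient.mk_surjective x
    obtain ⟨p, rfl⟩ := Ideal.Quotient.mk_surjective x
    rw [← hcomp, eq_comm, Ideal.Quotient.mk_eq_mk_iff_sub_mem, Ideal.mem_span_singleton] at hx
    obtain ⟨a, ha⟩ := hx
    obtain ⟨j, rfl⟩ := Nat.exists_eq_succ_of_ne_zero (Nat.one_le_iff_ne_zero.1 hk)
    refine ⟨p, algebraMap B A' t ^ j * a, ?_⟩
    rw [hsmul, MvPolynomial.aeval_C, ← mul_assoc, ← pow_succ', ← ha]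
    exact (add_sub_cancel _ _).symm
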